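/- For all positive integers p, q with 1 ≤ p < q and gcd(p,q) = 1, ψ(−p/q) = q/p − γ − ln(2q) − (π/2)·cot(π(q−p)/q) + 2·Σ_{j=1}^{⌊q/2⌋} cos(2π(q−p)j/q)·ln(sin(πj/q)), where ψ is the digamma function and γ is the Euler–Mascheroni constant. -/

import Mathlib

noncomputable def digamma (x : ℝ) : ℝ := deriv Real.Gamma x / Real.Gamma x

open Filter Topology Finset

lemma Real.differentiableAt_Gamma_of_pos {x : ℝ} (hx : 0 < x) :
    DifferentiableAt ℝ Real.Gamma x :=
  Real.differentiableAt_Gamma fun m => by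
    have : (0 : ℝ) ≤ m := m.cast_nonneg
    linarith

lemma digamma_eq_deriv_log_Gamma {x : ℝ} (hx : 0 < x) :
    digamma x = deriv (Real.log ∘ Real.Gamma) x := by
  rw [Function.comp_def, deriv.log (Real.differentiableAt_Gamma_of_pos hx)
    (Real.Gamma_pos_of_pos hx).ne', digamma]

lemma digamma_add_one {x : ℝ} (hx : ∀ m : ℕ, x ≠ -m) : digamma (x + 1) = digamma x + 1 / x := by
  have hx0 : x ≠ 0 := by simpa using hx 0
  have hG : Real.Gamma x ≠ 0 := Real.Gamma_ne_zero hx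
  have hd := (hasDerivAt_id x).mul (Real.differentiableAt_Gamma hx).hasDerivAt
  have heq : (fun s => Real.Gamma (s + 1)) =ᶠ[𝓝 x] id * Real.Gamma := by
    filter_upwards [eventually_ne_nhds hx0] with s hs
    simpa using Real.Gamma_add_one hs
  have h := (hd.congr_of_eventuallyEq heq).deriv
  rw [deriv_comp_add_const] at h
  rw [digamma, digamma, h, Real.Gamma_add_one hx0]
  simp only [id]
  field_simp
  ring

lemma digamma_add_nat {x : ℝ} (hx : 0 < x) (N : ℕ) :
    digamma (x + N) = digamma x + ∑ n ∈ range N, 1 / (x + n) := by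
  induction N with
  | zero => simp
  | succ N ih =>
    rw [Nat.cast_succ, ← add_assoc, digamma_add_one fun m => ?_, ih, sum_range_succ, add_assoc]
    have : (0 : ℝ) ≤ m := m.cast_nonneg
    have : (0 : ℝ) ≤ N := N.cast_nonneg
    linarith

lemma digamma_le_log {x : ℝ} (hx : 0 < x) : digamma x ≤ Real.log x := by
  rw [digamma_eq_deriv_log_Gamma hx]
  have hx1 : 0 < x + 1 := by linarith
  refine (Real.convexOn_log_Gamma.deriv_le_slope (Set.mem_Ioi.2 hx) (Set.mem_Ioi.2 hx1)
    (by linarith) ((Real.differentiableAt_Gamma_of_pos hx).log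
      (Real.Gamma_pos_of_pos hx).ne')).trans (le_of_eq ?_)
  rw [slope_def_field, add_sub_cancel_left, div_one, Function.comp_apply, Function.comp_apply,
    Real.Gamma_add_one hx.ne', Real.log_mul hx.ne' (Real.Gamma_pos_of_pos hx).ne',
    add_sub_cancel_right]

lemma log_le_digamma_add_one {x : ℝ} (hx : 0 < x) : Real.log x ≤ digamma (x + 1) := by
  have hx1 : 0 < x + 1 := by linarith
  rw [digamma_eq_deriv_log_Gamma hx1]
  refine (le_of_eq ?_).trans (Real.convexOn_log_Gamma.slope_le_deriv (Set.mem_Ioi.2 hx)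
    (Set.mem_Ioi.2 hx1) (by linarith) ((Real.differentiableAt_Gamma_of_pos hx1).log
      (Real.Gamma_pos_of_pos hx1).ne'))
  rw [slope_def_field, add_sub_cancel_left, div_one, Function.comp_apply, Function.comp_apply,
    Real.Gamma_add_one hx.ne', Real.log_mul hx.ne' (Real.Gamma_pos_of_pos hx).ne',
    add_sub_cancel_right]

lemma tendsto_log_sub_sum_digamma {x : ℝ} (hx : 0 < x) :
    Tendsto (fun N : ℕ => Real.log N - ∑ n ∈ range N, 1 / (x + n)) atTop (𝓝 (digamma x)) := by
  have hupper : Tendsto (fun N : ℕ => Real.log ((N : ℝ) + x) - Real.log N) atTop (𝓝 0) :=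
    (Real.tendsto_log_comp_add_sub_log x).comp tendsto_natCast_atTop_atTop
  have hlower : Tendsto (fun N : ℕ => Real.log ((N : ℝ) + (x - 1)) - Real.log N) atTop (𝓝 0) :=
    (Real.tendsto_log_comp_add_sub_log (x - 1)).comp tendsto_natCast_atTop_atTop
  have h0 : Tendsto (fun N : ℕ => digamma (x + N) - Real.log N) atTop (𝓝 0) := by
    refine tendsto_of_tendsto_of_tendsto_of_le_of_le' hlower hupper ?_ ?_
    · filter_upwards [eventually_ge_atTop 1] with N hN
      have : (1 : ℝ) ≤ N := by exact_mod_cast hN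
      have h := log_le_digamma_add_one (x := N + (x - 1)) (by linarith)
      rw [show (N : ℝ) + (x - 1) + 1 = x + N by ring] at h
      linarith
    · filter_upwards with N
      have h := digamma_le_log (x := x + N) (by positivity)
      rw [add_comm x] at h ⊢
      linarith
  have h := h0.const_sub (digamma x)
  rw [sub_zero] at h
  refine h.congr fun N => ?_
  rw [digamma_add_nat hx]
  ring

lemma digamma_one_sub_sub_digamma {x : ℝ} (hx : 0 < x) (hx1 : x < 1) :
    digamma (1 - x) - digamma x = Real.pi * Real.cot (Real.pi * x) := by
  have hy : 0 < 1 - x := by linarith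
  have hs : 0 < Real.sin (Real.pi * x) :=
    Real.sin_pos_of_pos_of_lt_pi (by positivity) (by nlinarith [Real.pi_pos])
  have h1 := (Real.differentiableAt_Gamma_of_pos hx).hasDerivAt.mul
    ((Real.differentiableAt_Gamma_of_pos hy).hasDerivAt.comp x ((hasDerivAt_id x).const_sub 1))
  have h2 := (((hasDerivAt_id x).const_mul Real.pi).sin.inv hs.ne').const_mul Real.pi
  have heq : Real.Gamma * (Real.Gamma ∘ fun s => 1 - id s)
      = fun s => Real.pi * (Real.sin (Real.pi * id s))⁻¹ := by
    ext s
    simpa [div_eq_mul_inv] using Real.Gamma_mul_Gamma_one_sub s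
  have h2' : HasDerivAt (Real.Gamma * (Real.Gamma ∘ fun s => 1 - id s)) _ x := heq ▸ h2
  have h := h1.unique h2'
  have hprod := Real.Gamma_mul_Gamma_one_sub x
  have hGx := Real.Gamma_pos_of_pos hx
  have hGy := Real.Gamma_pos_of_pos hy
  simp only [id, Function.comp_apply] at h
  rw [digamma, digamma, div_sub_div _ _ hGy.ne' hGx.ne', mul_comm (Real.Gamma (1 - x)) (Real.Gamma x), hprod,
    Real.cot_eq_cos_div_sin]
  generalize Real.sin (Real.pi * x) = S at hs h ⊢
  field_simp at h ⊢
  linarith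

lemma Complex.tendsto_sum_pow_div_neg_log {z : ℂ} (hz : ‖z‖ = 1) (hz1 : z ≠ 1) :
    Tendsto (fun n => ∑ i ∈ range n, z ^ (i + 1) / ((i : ℂ) + 1)) atTop
      (𝓝 (-Complex.log (1 - z))) := by
  have hbound (n : ℕ) : ‖∑ i ∈ range n, z ^ (i + 1)‖ ≤ 2 / ‖z - 1‖ := by
    have hpos : 0 < ‖z - 1‖ := norm_pos_iff.2 (sub_ne_zero.2 hz1)
    simp_rw [pow_succ]
    rw [← sum_mul, geom_sum_eq hz1, norm_mul, hz, mul_one, norm_div]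
    gcongr
    refine (norm_sub_le _ _).trans ?_
    rw [norm_pow, hz, one_pow, norm_one]
    norm_num
  have hanti : Antitone fun n : ℕ => 1 / ((n : ℝ) + 1) := fun a b hab => by
    dsimp only
    gcongr
  have hcauchy := hanti.cauchySeq_series_mul_of_tendsto_zero_of_bounded
    tendsto_one_div_add_atTop_nhds_zero_nat hbound
  obtain ⟨l, hl⟩ := cauchySeq_tendsto_of_complete hcauchy
  have hl' : Tendsto (fun n => ∑ i ∈ range n, z ^ (i + 1) / ((i : ℂ) + 1)) atTop (𝓝 l) := by
    refine hl.congr fun n => sum_congr rfl fun i _ => ?_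
    rw [Complex.real_smul]
    push_cast
    ring
  have hshift : Tendsto (fun n => ∑ i ∈ range n, z ^ i / (i : ℂ)) atTop (𝓝 l) := by
    rw [← tendsto_add_atTop_iff_nat 1]
    refine hl'.congr fun n => ?_
    rw [sum_range_succ']
    simp
  have habel := Complex.tendsto_tsum_powerSeries_nhdsWithin_lt hshift
  rw [tendsto_map'_iff] at habel
  have hre : z.re < 1 := by
    refine lt_of_le_of_ne (hz ▸ Complex.re_le_norm z) fun h => hz1 ?_
    have him : z.im = 0 := by
      have := Complex.sq_norm z
      rw [hz, Complex.normSq_apply, h] at this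
      nlinarith
    exact Complex.ext (by simpa using h) (by simpa using him)
  have hlog : Tendsto (fun x : ℝ => -Complex.log (1 - z * x)) (𝓝[<] 1)
      (𝓝 (-Complex.log (1 - z))) := by
    have hc : ContinuousAt (fun x : ℝ => -Complex.log (1 - z * x)) 1 := by
      refine (ContinuousAt.clog (by fun_prop) (Or.inl ?_)).neg
      simpa using hre
    simpa [ContinuousAt] using hc.tendsto.mono_left nhdsWithin_le_nhds
  have hl_eq : l = -Complex.log (1 - z) := by
    refine tendsto_nhds_unique habel (hlog.congr' ?_)
    filter_upwards [Ioo_mem_nhdsLT (show (0 : ℝ) < 1 by norm_num)] with x hx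
    have hn : ‖z * x‖ < 1 := by
      rw [norm_mul, hz, one_mul, Complex.norm_real, Real.norm_of_nonneg hx.1.le]
      exact hx.2
    rw [← (Complex.hasSum_taylorSeries_neg_log hn).tsum_eq]
    refine tsum_congr fun n => ?_
    rw [mul_pow]
    ring
  exact hl_eq ▸ hl'

lemma Real.tendsto_sum_cos_div {θ : ℝ} (h0 : 0 < θ) (h1 : θ < 2 * Real.pi) :
    Tendsto (fun n => ∑ i ∈ range n, Real.cos (θ * ((i + 1 : ℕ) : ℝ)) / ((i + 1 : ℕ) : ℝ)) atTop
      (𝓝 (-Real.log (2 * Real.sin (θ / 2)))) := by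
  have hs : 0 < Real.sin (θ / 2) := Real.sin_pos_of_pos_of_lt_pi (by linarith) (by linarith)
  have hn : ‖Complex.exp (Complex.I * θ) - 1‖ = 2 * Real.sin (θ / 2) := by
    rw [Complex.norm_exp_I_mul_ofReal_sub_one, Real.norm_of_nonneg (by positivity)]
  have hne : Complex.exp (Complex.I * θ) ≠ 1 := fun h => by
    rw [h, sub_self, norm_zero] at hn
    linarith
  have h := (Complex.continuous_re.tendsto _).comp
    (Complex.tendsto_sum_pow_div_neg_log (by rw [mul_comm, Complex.norm_exp_ofReal_mul_I]) hne)
  rw [Complex.neg_re, Complex.log_re, norm_sub_rev, hn] at h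
  refine h.congr fun n => ?_
  rw [Function.comp_apply, Complex.re_sum]
  refine sum_congr rfl fun i _ => ?_
  rw [← Complex.exp_nat_mul, ← Nat.cast_succ, Complex.div_natCast_re,
    show ((i + 1 : ℕ) : ℂ) * (Complex.I * θ) = ((θ * ((i + 1 : ℕ) : ℝ) : ℝ) : ℂ) * Complex.I by
      push_cast; ring, Complex.exp_ofReal_mul_I_re]

lemma sum_range_periodic_mul_sum_one_div {c : ℕ → ℝ} {q : ℕ} (hq : 0 < q)
    (hc : Function.Periodic c q) (N : ℕ) :
    ∑ i ∈ range q, c (i + 1) * ∑ n ∈ range N, 1 / (((i + 1 : ℕ) : ℝ) / q + n)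
      = q * ∑ m ∈ range (q * N), c (m + 1) / ((m + 1 : ℕ) : ℝ) := by
  induction N with
  | zero => simp
  | succ N ih =>
    simp_rw [sum_range_succ, mul_add, sum_add_distrib]
    rw [ih, mul_one, sum_range_add, mul_add, add_right_inj, mul_sum]
    refine sum_congr rfl fun i _ => ?_
    rw [show q * N + i + 1 = i + 1 + N * q by ring, show c (i + 1 + N * q) = c (i + 1) by simpa using hc.nat_mul N (i + 1)]
    push_cast
    field_simp

lemma sum_range_cos_two_pi_mul_div {q : ℕ} (hq : 0 < q) (k : ℤ) :
    ∑ j ∈ range q, Real.cos (2 * Real.pi * k * j / q) = if (q : ℤ) ∣ k then (q : ℝ) else 0 := by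
  have hq0 : (q : ℝ) ≠ 0 := by positivity
  have hqc : (q : ℂ) ≠ 0 := by exact_mod_cast hq0
  split_ifs with h
  · obtain ⟨m, rfl⟩ := h
    rw [sum_congr rfl fun j _ => ?_, sum_const, card_range, nsmul_one]
    rw [Real.cos_eq_one_iff]
    refine ⟨m * j, ?_⟩
    push_cast
    field_simp
  · set z := Complex.exp (2 * Real.pi * Complex.I * k / q) with hz
    have hz1 : z ≠ 1 := fun hz1 => h <| by
      obtain ⟨n, hn⟩ := Complex.exp_eq_one_iff.1 hz1
      refine ⟨n, ?_⟩
      have hpi := Complex.two_pi_I_ne_zero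
      rw [div_eq_iff hqc] at hn
      have : (k : ℂ) = q * n := mul_left_cancel₀ hpi (by rw [hn]; ring)
      exact_mod_cast this
    have hzq : z ^ q = 1 := by
      rw [hz, ← Complex.exp_nat_mul, Complex.exp_eq_one_iff]
      exact ⟨k, by field_simp⟩
    have hsum : ∑ j ∈ range q, z ^ j = 0 := by rw [geom_sum_eq hz1, hzq, sub_self, zero_div]
    have hre := congrArg Complex.re hsum
    rw [Complex.re_sum, Complex.zero_re] at hre
    rw [← hre]
    refine sum_congr rfl fun j _ => ?_
    rw [hz, ← Complex.exp_nat_mul, show (j : ℂ) * (2 * Real.pi * Complex.I * k / q)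
      = ((2 * Real.pi * k * j / q : ℝ) : ℂ) * Complex.I by push_cast; ring,
      Complex.exp_ofReal_mul_I_re]

lemma sum_cos_mul_digamma {q j : ℕ} (hj : 0 < j) (hjq : j < q) :
    ∑ i ∈ range q, Real.cos (2 * Real.pi * j / q * ((i + 1 : ℕ) : ℝ))
        * digamma (((i + 1 : ℕ) : ℝ) / q)
      = q * Real.log (2 * Real.sin (Real.pi * j / q)) := by
  have hq : 0 < q := hj.trans hjq
  have hq0 : (0 : ℝ) < q := by exact_mod_cast hq
  have hj0 : (0 : ℝ) < j := by exact_mod_cast hj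
  have hjq0 : (j : ℝ) < q := by exact_mod_cast hjq
  set c : ℕ → ℝ := fun m => Real.cos (2 * Real.pi * j / q * (m : ℝ)) with hc
  have hper : Function.Periodic c q := fun m => by
    simp only [hc]
    rw [← Real.cos_add_nat_mul_two_pi (2 * Real.pi * j / q * (m : ℝ)) j]
    congr 1
    push_cast
    field_simp
  have hsum : ∑ i ∈ range q, c (i + 1) = 0 := by
    have h := sum_range_cos_two_pi_mul_div hq j
    rw [if_neg (by exact_mod_cast Nat.not_dvd_of_pos_of_lt hj hjq)] at h
    have h2 := (sum_range_succ c q).symm.trans (sum_range_succ' c q)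
    have h3 : c q = c 0 := by simpa using hper 0
    rw [h3, add_left_inj] at h2
    rw [← h2, ← h]
    refine sum_congr rfl fun i _ => ?_
    simp only [hc]
    congr 1
    push_cast
    ring
  have h1 := tendsto_finsetSum (range q) fun i _ =>
    (tendsto_log_sub_sum_digamma (x := ((i + 1 : ℕ) : ℝ) / q) (by positivity)).const_mul (c (i + 1))
  have h2 := ((Real.tendsto_sum_cos_div (θ := 2 * Real.pi * j / q) (by positivity)
    (by rw [div_lt_iff₀ hq0]; gcongr)).comp (tendsto_id.const_mul_atTop' hq)).const_mul (-(q : ℝ))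
  refine (tendsto_nhds_unique h1 (h2.congr fun N => ?_)).trans ?_
  · simp_rw [mul_sub, sum_sub_distrib]
    rw [← sum_mul, hsum, sum_range_periodic_mul_sum_one_div hq hper]
    simp [hc]
  · rw [neg_mul_neg, show 2 * Real.pi * j / q / 2 = Real.pi * j / q by ring]

lemma sum_digamma {q : ℕ} (hq : 0 < q) :
    ∑ i ∈ range q, digamma (((i + 1 : ℕ) : ℝ) / q)
      = -q * Real.eulerMascheroniConstant - q * Real.log q := by
  have hq0 : (0 : ℝ) < q := by exact_mod_cast hq
  have h1 := tendsto_finsetSum (range q) fun i _ =>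
    tendsto_log_sub_sum_digamma (x := ((i + 1 : ℕ) : ℝ) / q) (by positivity)
  have h2 := ((Real.tendsto_harmonic_sub_log.comp (tendsto_id.const_mul_atTop' hq)).const_mul
    (-(q : ℝ))).sub_const (q * Real.log q)
  refine tendsto_nhds_unique h1 (h2.congr' ?_)
  filter_upwards [eventually_ge_atTop 1] with N hN
  have hN0 : (N : ℝ) ≠ 0 := by positivity
  have h := sum_range_periodic_mul_sum_one_div (c := fun _ => 1) hq (fun _ => rfl) N
  simp only [one_mul] at h
  rw [sum_sub_distrib, h, sum_const, card_range, nsmul_eq_mul]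
  simp only [Function.comp_apply, id, harmonic, Nat.cast_mul, Real.log_mul hq0.ne' hN0]
  push_cast
  simp only [one_div]
  ring

lemma Finset.sum_Ico_one_eq_two_mul_of_reflect {f : ℕ → ℝ} {q : ℕ}
    (hf : ∀ j ∈ Ico 1 q, f (q - j) = f j) (hmid : ∀ j, 2 * j = q → f j = 0) (hq : 1 < q) :
    ∑ j ∈ Ico 1 q, f j = 2 * ∑ j ∈ Icc 1 (q / 2), f j := by
  have hrefl : ∑ j ∈ Ico (q / 2 + 1) q, f j = ∑ j ∈ Ico 1 (q - q / 2), f j := by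
    have h := sum_Ico_reflect f (q / 2 + 1) (m := q) (n := q) (by omega)
    rw [show q + 1 - q = 1 by omega, show q + 1 - (q / 2 + 1) = q - q / 2 by omega] at h
    rw [← h]
    refine sum_congr rfl fun j hj => (hf j ?_).symm
    rw [mem_Ico] at hj ⊢
    omega
  have hhalf : ∑ j ∈ Ico 1 (q - q / 2), f j = ∑ j ∈ Ico 1 (q / 2 + 1), f j := by
    rcases Nat.even_or_odd' q with ⟨m, h | h⟩
    · rw [sum_Ico_succ_top (by omega), hmid (q / 2) (by omega), add_zero]
      congr 2
      omega
    · congr 2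
      omega
  rw [← sum_Ico_consecutive f (show 1 ≤ q / 2 + 1 by omega) (show q / 2 + 1 ≤ q by omega), hrefl,
    hhalf, ← two_mul]
  rfl

lemma digamma_add_digamma_one_sub {q r : ℕ} (hr : 0 < r) (hrq : r < q) :
    digamma ((r : ℝ) / q) + digamma (1 - (r : ℝ) / q)
      = -2 * Real.eulerMascheroniConstant - 2 * Real.log (2 * q)
        + 2 * ∑ j ∈ Ico 1 q, Real.cos (2 * Real.pi * r * j / q)
            * Real.log (Real.sin (Real.pi * j / q)) := by
  have hq : 0 < q := hr.trans hrq
  have hq0 : (0 : ℝ) < q := by exact_mod_cast hq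
  have horth (s : ℕ) : ∑ j ∈ range q, Real.cos (2 * Real.pi * r * j / q)
        * Real.cos (2 * Real.pi * j / q * (s : ℝ))
      = ((if (q : ℤ) ∣ (r : ℤ) - s then (q : ℝ) else 0)
        + if (q : ℤ) ∣ (r : ℤ) + s then (q : ℝ) else 0) / 2 := by
    rw [← sum_range_cos_two_pi_mul_div hq, ← sum_range_cos_two_pi_mul_div hq, ← sum_add_distrib,
      sum_div]
    refine sum_congr rfl fun j _ => ?_
    have h := Real.two_mul_cos_mul_cos (2 * Real.pi * r * j / q) (2 * Real.pi * j / q * s)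
    rw [show 2 * Real.pi * r * j / q - 2 * Real.pi * j / q * s
        = 2 * Real.pi * ((r - s : ℤ) : ℝ) * j / q by push_cast; ring,
      show 2 * Real.pi * r * j / q + 2 * Real.pi * j / q * s
        = 2 * Real.pi * ((r + s : ℤ) : ℝ) * j / q by push_cast; ring] at h
    linarith
  have hinv : ∑ j ∈ range q, Real.cos (2 * Real.pi * r * j / q)
        * ∑ i ∈ range q, Real.cos (2 * Real.pi * j / q * ((i + 1 : ℕ) : ℝ))
          * digamma (((i + 1 : ℕ) : ℝ) / q)
      = q / 2 * (digamma ((r : ℝ) / q) + digamma (1 - (r : ℝ) / q)) := by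
    simp_rw [mul_sum, ← mul_assoc]
    rw [sum_comm]
    simp_rw [← sum_mul, horth, add_div, add_mul, sum_add_distrib]
    rw [sum_eq_single (r - 1), sum_eq_single (q - r - 1)]
    · rw [Nat.sub_add_cancel hr, Nat.sub_add_cancel (by omega), Nat.cast_sub hrq.le,
        Nat.cast_sub hrq.le, sub_self, add_sub_cancel, if_pos (dvd_zero _), if_pos dvd_rfl,
        sub_div, div_self hq0.ne']
      ring
    · intro i hi hne
      rw [mem_range] at hi
      rw [if_neg, zero_div, zero_mul]
      rintro ⟨m, hm⟩
      have hm1 : 0 < m := by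
        by_contra hcon
        have := mul_nonpos_of_nonneg_of_nonpos (Int.natCast_nonneg q) (not_lt.1 hcon)
        push_cast at hm
        omega
      have hm2 : m < 2 := by
        by_contra hcon
        have := mul_le_mul_of_nonneg_left (not_lt.1 hcon) (Int.natCast_nonneg q)
        push_cast at hm
        omega
      obtain rfl : m = 1 := by omega
      push_cast at hm
      omega
    · intro h
      exact absurd (mem_range.2 (by omega)) h
    · intro i hi hne
      rw [mem_range] at hi
      rw [if_neg, zero_div, zero_mul]
      intro hd
      have := Int.eq_zero_of_abs_lt_dvd hd (by rw [abs_lt]; push_cast; omega)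
      push_cast at this
      omega
    · intro h
      exact absurd (mem_range.2 (by omega)) h
  have hcos : ∑ j ∈ Ico 1 q, Real.cos (2 * Real.pi * r * j / q) = -1 := by
    have h := sum_range_cos_two_pi_mul_div hq r
    rw [if_neg (by exact_mod_cast Nat.not_dvd_of_pos_of_lt hr hrq), range_eq_Ico,
      sum_eq_sum_Ico_succ_bot hq] at h
    simp only [Nat.cast_zero, mul_zero, zero_div, Real.cos_zero, Int.cast_natCast, zero_add] at h
    linarith
  rw [range_eq_Ico, sum_eq_sum_Ico_succ_bot hq, ← range_eq_Ico] at hinv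
  simp only [Nat.cast_zero, mul_zero, zero_div, zero_mul, Real.cos_zero, one_mul, zero_add] at hinv
  have hlog : ∀ j ∈ Ico 1 q, Real.cos (2 * Real.pi * r * j / q)
        * ∑ i ∈ range q, Real.cos (2 * Real.pi * j / q * ((i + 1 : ℕ) : ℝ))
          * digamma (((i + 1 : ℕ) : ℝ) / q)
      = q * (Real.cos (2 * Real.pi * r * j / q) * Real.log (Real.sin (Real.pi * j / q)))
        + Real.cos (2 * Real.pi * r * j / q) * (q * Real.log 2) := fun j hj => by
    rw [mem_Ico] at hj
    have hs : 0 < Real.sin (Real.pi * j / q) := by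
      have hj0 : (0 : ℝ) < j := by exact_mod_cast hj.1
      have hjq : (j : ℝ) < q := by exact_mod_cast hj.2
      refine Real.sin_pos_of_pos_of_lt_pi (by positivity) ?_
      rw [div_lt_iff₀ hq0]
      exact mul_lt_mul_of_pos_left hjq Real.pi_pos
    rw [sum_cos_mul_digamma hj.1 hj.2, Real.log_mul two_ne_zero hs.ne']
    ring
  rw [sum_digamma hq, sum_congr rfl hlog, sum_add_distrib, ← mul_sum, ← sum_mul, hcos] at hinv
  rw [Real.log_mul two_ne_zero hq0.ne']
  refine mul_left_cancel₀ (show (q : ℝ) / 2 ≠ 0 by positivity) ?_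
  rw [← hinv]
  ring

/-- **Gauss's digamma theorem**. -/
lemma digamma_nat_div_nat {q r : ℕ} (hr : 0 < r) (hrq : r < q) :
    digamma ((r : ℝ) / q) = -Real.eulerMascheroniConstant - Real.log (2 * q)
      - (Real.pi / 2) * Real.cot (Real.pi * r / q)
      + 2 * ∑ j ∈ Icc 1 (q / 2), Real.cos (2 * Real.pi * r * j / q)
          * Real.log (Real.sin (Real.pi * j / q)) := by
  have hq0 : (0 : ℝ) < q := by exact_mod_cast hr.trans hrq
  have hr0 : (0 : ℝ) < r := by exact_mod_cast hr
  have hadd := digamma_add_digamma_one_sub hr hrq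
  rw [sum_Ico_one_eq_two_mul_of_reflect ?_ ?_ (by omega)] at hadd
  · have hsub := digamma_one_sub_sub_digamma (x := (r : ℝ) / q) (by positivity)
      (by rw [div_lt_one hq0]; exact_mod_cast hrq)
    rw [← mul_div_assoc] at hsub
    linarith
  · intro j hj
    rw [mem_Ico] at hj
    rw [Nat.cast_sub hj.2.le, show Real.pi * ((q : ℝ) - j) / q = Real.pi - Real.pi * j / q by
      field_simp, Real.sin_pi_sub, show 2 * Real.pi * r * ((q : ℝ) - j) / q
        = r * (2 * Real.pi) - 2 * Real.pi * r * j / q by field_simp, Real.cos_nat_mul_two_pi_sub]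
  · rintro j rfl
    have hj0 : (j : ℝ) ≠ 0 := fun h => by simp [h] at hq0
    rw [show Real.pi * j / ((2 * j : ℕ) : ℝ) = Real.pi / 2 by push_cast; field_simp,
      Real.sin_pi_div_two, Real.log_one, mul_zero]

theorem digamma_neg_p_div_q_formula (p q : ℕ) (hp : 1 ≤ p) (hpq : p < q)
    (hgcd : Nat.gcd p q = 1) :
    digamma (-(p : ℝ) / q) =
      (q : ℝ) / p - Real.eulerMascheroniConstant - Real.log (2 * q)
        - (Real.pi / 2) * Real.cot (Real.pi * ((q : ℝ) - p) / q)
        + 2 * ∑ j ∈ Finset.Icc 1 (q / 2),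
            Real.cos (2 * Real.pi * ((q : ℝ) - p) * j / q)
              * Real.log (Real.sin (Real.pi * j / q)) := by
  have hp0 : (0 : ℝ) < p := by exact_mod_cast hp
  have hpq0 : (p : ℝ) < q := by exact_mod_cast hpq
  have hq0 : (0 : ℝ) < q := hp0.trans hpq0
  have hlt : -1 < -(p : ℝ) / q := by
    rw [lt_div_iff₀ hq0]
    linarith
  have hneg : -(p : ℝ) / q < 0 := div_neg_of_neg_of_pos (by linarith) hq0
  have hadd := digamma_add_one (x := -(p : ℝ) / q) fun m hm => by
    rw [hm] at hlt hneg
    have h1 : 0 < m := by exact_mod_cast neg_lt_zero.1 hneg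
    have h2 : m < 1 := by exact_mod_cast neg_lt_neg_iff.1 hlt
    omega
  have hgauss := digamma_nat_div_nat (q := q) (r := q - p) (by omega) (by omega)
  rw [Nat.cast_sub hpq.le] at hgauss
  rw [show -(p : ℝ) / q + 1 = ((q : ℝ) - p) / q by field_simp; ring, hgauss,
    show 1 / (-(p : ℝ) / q) = -((q : ℝ) / p) by field_simp] at hadd
  linarith
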